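/- arXiv:0712.0459 — 2 statements merged into one kernel-verified Lean document; each statement's English description precedes it below -/
import Mathlib

section
/- Let X be a regularly varying random vector in ℝ^d, X ∈ RV(α, μ), and let A_n be a sequence of ℝ^d-valued random vectors with A_n ≠ 0, each A_n independent of X, such that A_n → A ≠ 0 almost surely as n → ∞ and E[(sup_n |A_n|_∞)^{α + δ}] < ∞ for some δ > 0, where |a|_∞ = sup_{|x| = 1} |a · x|. Then for every positive sequence λ_n increasing to ∞ and every x > 0, P(A_n · X > λ_n x) / P(|X| > λ_n) → x^{-α} · E[μ({z ∈ ℝ^d : A · z > 1})] as n → ∞ (when A is deterministic this equals x^{-α} μ({z : A · z > 1})). -/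
open MeasureTheory ProbabilityTheory Filter Finset Pointwise

noncomputable section

/-- A random vector `X` in `ℝ^d` (with the Euclidean norm) is regularly varying with index
`α > 0` and limit measure `μ`: `μ` is a nonzero Borel measure, finite on Borel sets bounded
away from `0`, homogeneous of order `-α`, normalized by `μ {‖z‖ > 1} = 1`, and
`P (X ∈ x B) / P (‖X‖ > x) → μ B` for all Borel `B` bounded away from `0` with
`μ`-null boundary. -/
def IsRegVarVec {Ω : Type*} [MeasurableSpace Ω] {d : ℕ} (P : Measure Ω)
    (X : Ω → EuclideanSpace ℝ (Fin d)) (α : ℝ) (μ : Measure (EuclideanSpace ℝ (Fin d))) :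
    Prop :=
  0 < α ∧ μ ≠ 0 ∧
  (∀ B : Set (EuclideanSpace ℝ (Fin d)), MeasurableSet B →
    (0 : EuclideanSpace ℝ (Fin d)) ∉ closure B → μ B < ⊤) ∧
  (∀ t : ℝ, 0 < t → ∀ B : Set (EuclideanSpace ℝ (Fin d)), MeasurableSet B →
    μ (t • B) = ENNReal.ofReal (t ^ (-α)) * μ B) ∧
  μ {z | 1 < ‖z‖} = 1 ∧
  (∀ B : Set (EuclideanSpace ℝ (Fin d)), MeasurableSet B →
    (0 : EuclideanSpace ℝ (Fin d)) ∉ closure B → μ (frontier B) = 0 →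
    Tendsto (fun x : ℝ => (P (X ⁻¹' (x • B))).toReal / (P {ω | x < ‖X ω‖}).toReal)
      atTop (nhds (μ B).toReal))

/-- A real random variable `Y` is regularly varying with index `α > 0` and tail balance
parameter `p ∈ [0, 1]`. -/
def IsRegVarRV {Ω : Type*} [MeasurableSpace Ω] (P : Measure Ω) (Y : Ω → ℝ) (α p : ℝ) :
    Prop :=
  0 < α ∧ 0 ≤ p ∧ p ≤ 1 ∧
  ∀ t : ℝ, 0 < t →
    Tendsto (fun x : ℝ => (P {ω | t * x < Y ω}).toReal / (P {ω | x < |Y ω|}).toReal)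
      atTop (nhds (p * t ^ (-α))) ∧
    Tendsto (fun x : ℝ => (P {ω | Y ω ≤ -(t * x)}).toReal / (P {ω | x < |Y ω|}).toReal)
      atTop (nhds ((1 - p) * t ^ (-α)))

/-- A function `L : (0, ∞) → (0, ∞)` is slowly varying if `L (t x) / L x → 1` as `x → ∞`
for every `t > 0`. -/
def SlowlyVarying (L : ℝ → ℝ) : Prop :=
  (∀ x : ℝ, 0 < x → 0 < L x) ∧
  ∀ t : ℝ, 0 < t → Tendsto (fun x => L (t * x) / L x) atTop (nhds 1)

open Topology in
/-- The upper tail of a positively homogeneous continuous functional of a regularly varying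
vector, relative to the tail of the norm, has the limit prescribed by the limit measure. -/
lemma IsRegVarVec.tendsto_tail {Ω : Type*} [MeasurableSpace Ω] {d : ℕ} {P : Measure Ω}
    {X : Ω → EuclideanSpace ℝ (Fin d)} {α : ℝ} {μ : Measure (EuclideanSpace ℝ (Fin d))}
    (h : IsRegVarVec P X α μ) {f : EuclideanSpace ℝ (Fin d) → ℝ} (hf : Continuous f)
    (hhom : ∀ t : ℝ, 0 < t → ∀ z, f (t • z) = t * f z) {c : ℝ} (hc : 0 < c) :
    Tendsto (fun t : ℝ => P.real {ω | t * c < f (X ω)} / P.real {ω | t < ‖X ω‖})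
      atTop (𝓝 (c ^ (-α) * μ.real {z | 1 < f z})) := by
  obtain ⟨-, -, hfin, hμ, -, hlim⟩ := h
  have hf0 : f 0 = 0 := by
    have := hhom 2 two_pos 0
    rw [smul_zero] at this
    linarith
  have hsmul : ∀ t : ℝ, 0 < t → ∀ s : ℝ, t • {z | s < f z} = {z | t * s < f z} := by
    intro t ht s
    ext z
    rw [Set.mem_smul_set_iff_inv_smul_mem₀ ht.ne', Set.mem_ofPred_eq, Set.mem_ofPred_eq,
      hhom _ (inv_pos.2 ht), lt_inv_mul_iff₀ ht]
  have hopen : ∀ s : ℝ, IsOpen {z | s < f z} := fun s => isOpen_lt continuous_const hf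
  have hzero : ∀ s : ℝ, 0 < s → (0 : EuclideanSpace ℝ (Fin d)) ∉ closure {z | s < f z} := by
    intro s hs h0
    have := closure_lt_subset_le continuous_const hf h0
    rw [Set.mem_ofPred_eq, hf0] at this
    linarith
  have hlevel : ∀ s : ℝ, 0 < s →
      μ.real {z | s < f z} = s ^ (-α) * μ.real {z | 1 < f z} := by
    intro s hs
    have h1 := hμ s hs {z | 1 < f z} (hopen 1).measurableSet
    rw [hsmul s hs, mul_one] at h1
    rw [Measure.real, h1, ENNReal.toReal_mul,
      ENNReal.toReal_ofReal (Real.rpow_nonneg hs.le _), Measure.real]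
  have hne : ∀ s : ℝ, 0 < s → μ {z | s < f z} ≠ ⊤ := fun s hs =>
    (hfin _ (hopen s).measurableSet (hzero s hs)).ne
  have hnull : μ {z | f z = c} = 0 := by
    have hsub : ∀ s : ℝ, 0 < s → s < c →
        μ.real {z | f z = c} ≤ s ^ (-α) * μ.real {z | 1 < f z}
          - c ^ (-α) * μ.real {z | 1 < f z} := by
      intro s hs hsc
      rw [← hlevel s hs, ← hlevel c hc, ← measureReal_sdiff
        (show {z | c < f z} ⊆ {z | s < f z} from fun z hz => hsc.trans hz)
        (hopen c).measurableSet (hne s hs)]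
      refine measureReal_mono (fun z hz => ?_)
        (ne_top_of_le_ne_top (hne s hs) (measure_mono Set.sdiff_subset))
      rw [Set.mem_ofPred_eq] at hz
      exact ⟨by rw [Set.mem_ofPred_eq, hz]; exact hsc, by simp [hz]⟩
    have hcont : Tendsto (fun s : ℝ => s ^ (-α) * μ.real {z | 1 < f z}
        - c ^ (-α) * μ.real {z | 1 < f z}) (𝓝[<] c) (𝓝 0) := by
      have h1 := ((Real.continuousAt_rpow_const c (-α) (Or.inl hc.ne')).mul_const
        (μ.real {z | 1 < f z})).sub_const (c ^ (-α) * μ.real {z | 1 < f z})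
      rw [sub_self] at h1
      exact tendsto_nhdsWithin_of_tendsto_nhds h1
    have hle : μ.real {z | f z = c} ≤ 0 := by
      refine ge_of_tendsto hcont ?_
      filter_upwards [Ioo_mem_nhdsLT hc] with s hs using hsub s hs.1 hs.2
    have heq := le_antisymm hle measureReal_nonneg
    refine (measureReal_eq_zero_iff ?_).1 heq
    refine ne_top_of_le_ne_top (hne (c / 2) (by linarith)) (measure_mono fun z hz => ?_)
    rw [Set.mem_ofPred_eq] at hz ⊢
    linarith
  have hfr : μ (frontier {z | c < f z}) = 0 :=
    measure_mono_null (fun z hz => (frontier_lt_subset_eq continuous_const hf hz).symm) hnull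
  have := hlim _ (hopen c).measurableSet (hzero c hc) hfr
  rw [← hlevel c hc]
  refine this.congr' ?_
  filter_upwards [eventually_gt_atTop 0] with t ht
  rw [hsmul t ht]
  rfl

open Topology in
/-- The tail of the norm of a regularly varying vector is a regularly varying function. -/
lemma IsRegVarVec.tendsto_norm_tail {Ω : Type*} [MeasurableSpace Ω] {d : ℕ} {P : Measure Ω}
    {X : Ω → EuclideanSpace ℝ (Fin d)} {α : ℝ} {μ : Measure (EuclideanSpace ℝ (Fin d))}
    (h : IsRegVarVec P X α μ) {c : ℝ} (hc : 0 < c) :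
    Tendsto (fun t : ℝ => P.real {ω | t * c < ‖X ω‖} / P.real {ω | t < ‖X ω‖})
      atTop (𝓝 (c ^ (-α))) := by
  have h1 := h.tendsto_tail continuous_norm
    (fun t ht z => by rw [norm_smul, Real.norm_of_nonneg ht.le]) hc
  have hμ : μ.real {z | 1 < ‖z‖} = 1 := by rw [Measure.real, h.2.2.2.2.1, ENNReal.toReal_one]
  rwa [hμ, mul_one] at h1

/-- The tail of the norm of a regularly varying vector is everywhere positive. -/
lemma IsRegVarVec.tail_pos {Ω : Type*} [MeasurableSpace Ω] {d : ℕ} {P : Measure Ω}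
    [IsFiniteMeasure P]
    {X : Ω → EuclideanSpace ℝ (Fin d)} {α : ℝ} {μ : Measure (EuclideanSpace ℝ (Fin d))}
    (h : IsRegVarVec P X α μ) (t : ℝ) : 0 < P.real {ω | t < ‖X ω‖} := by
  have h1 := h.tendsto_norm_tail one_pos
  rw [Real.one_rpow] at h1
  obtain ⟨s, hs, hts⟩ :=
    ((h1.eventually (lt_mem_nhds one_half_lt_one)).and (eventually_ge_atTop t)).exists
  have hs0 : P.real {ω | s < ‖X ω‖} ≠ 0 := by
    intro h0
    rw [h0, div_zero] at hs
    norm_num at hs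
  exact (measureReal_nonneg.lt_of_ne' hs0).trans_le
    (measureReal_mono fun ω hω => hts.trans_lt hω)

/-- An upper Potter-type bound for antitone functions with controlled doubling. -/
lemma potter_bound {G : ℝ → ℝ} (hG : Antitone G) (hpos : ∀ t, 0 < G t) (hone : ∀ t, G t ≤ 1)
    {β t₀ : ℝ} (hβ : 0 < β) (ht₀ : 0 < t₀)
    (hdouble : ∀ t, t₀ ≤ t → G t ≤ 2 ^ β * G (2 * t)) {s t : ℝ} (hs : 1 ≤ s) (ht : t₀ ≤ t) :
    G (t / s) ≤ (G t₀)⁻¹ * 2 ^ β * s ^ β * G t := by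
  have hiter : ∀ (n : ℕ) (u : ℝ), t₀ ≤ u → G u ≤ ((2 : ℝ) ^ n) ^ β * G (2 ^ n * u) := by
    intro n
    induction n with
    | zero => intro u _; simp
    | succ n ih =>
      intro u hu
      have h2 : t₀ ≤ 2 * u := by linarith
      calc G u ≤ 2 ^ β * G (2 * u) := hdouble u hu
        _ ≤ 2 ^ β * (((2 : ℝ) ^ n) ^ β * G (2 ^ n * (2 * u))) := by
          gcongr
          exact ih _ h2
        _ = ((2 : ℝ) ^ (n + 1)) ^ β * G (2 ^ (n + 1) * u) := by
          rw [pow_succ, Real.mul_rpow (by positivity) (by positivity),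
            show (2 : ℝ) ^ n * (2 * u) = 2 ^ n * 2 * u by ring]
          ring
  have hlarge : ∀ r : ℝ, 1 ≤ r → t₀ ≤ t / r → G (t / r) ≤ 2 ^ β * r ^ β * G t := by
    intro r hr htr
    obtain ⟨n, hn1, hn2⟩ := exists_nat_pow_near hr (one_lt_two (α := ℝ))
    have hr0 : 0 < r := by linarith
    calc G (t / r) ≤ ((2 : ℝ) ^ (n + 1)) ^ β * G (2 ^ (n + 1) * (t / r)) := hiter _ _ htr
      _ ≤ (2 * r) ^ β * G t := by
        have h2 : (2 : ℝ) ^ (n + 1) ≤ 2 * r := by rw [pow_succ]; linarith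
        have h3 : G (2 ^ (n + 1) * (t / r)) ≤ G t := by
          apply hG
          rw [← mul_div_assoc, le_div_iff₀ hr0, mul_comm]
          exact mul_le_mul_of_nonneg_right hn2.le (ht₀.le.trans ht)
        have := (hpos t).le
        have := (hpos (2 ^ (n + 1) * (t / r))).le
        gcongr
      _ = 2 ^ β * r ^ β * G t := by rw [Real.mul_rpow zero_le_two hr0.le]
  have hK : 1 ≤ (G t₀)⁻¹ := (one_le_inv₀ (hpos t₀)).2 (hone t₀)
  have hs0 : 0 < s := by linarith
  have ht0 : 0 < t := ht₀.trans_le ht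
  have hGt := hpos t
  rcases le_or_gt t₀ (t / s) with h | h
  · refine (hlarge s hs h).trans ?_
    rw [mul_assoc (G t₀)⁻¹, mul_assoc (G t₀)⁻¹]
    exact le_mul_of_one_le_left (by positivity) hK
  · have h1 := hlarge (t / t₀) ((one_le_div ht₀).2 ht) (by rw [div_div_cancel₀ ht0.ne'])
    rw [div_div_cancel₀ ht0.ne'] at h1
    have h2 : t / t₀ ≤ s := by
      rw [div_lt_iff₀ hs0] at h
      rw [div_le_iff₀ ht₀]
      linarith
    calc G (t / s) ≤ (G t₀)⁻¹ * G t₀ := by rw [inv_mul_cancel₀ (hpos t₀).ne']; exact hone _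
      _ ≤ (G t₀)⁻¹ * (2 ^ β * s ^ β * G t) := by
        have := (hpos t₀).le
        refine mul_le_mul_of_nonneg_left (h1.trans ?_) (by positivity)
        gcongr
      _ = _ := by ring

/-- Potter bound for the tail of the norm of a regularly varying vector. -/
lemma IsRegVarVec.exists_potter_bound {Ω : Type*} [MeasurableSpace Ω] {d : ℕ} {P : Measure Ω}
    [IsProbabilityMeasure P]
    {X : Ω → EuclideanSpace ℝ (Fin d)} {α : ℝ} {μ : Measure (EuclideanSpace ℝ (Fin d))}
    (h : IsRegVarVec P X α μ) {δ : ℝ} (hδ : 0 < δ) :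
    ∃ C t₀ : ℝ, 0 ≤ C ∧ ∀ s t : ℝ, 1 ≤ s → t₀ ≤ t →
      P.real {ω | t / s < ‖X ω‖} ≤ C * s ^ (α + δ) * P.real {ω | t < ‖X ω‖} := by
  have h1 := h.tendsto_norm_tail two_pos
  have hlt : (2 : ℝ) ^ (-(α + δ)) < 2 ^ (-α) :=
    Real.rpow_lt_rpow_of_exponent_lt one_lt_two (by linarith)
  obtain ⟨t₁, ht₁⟩ := eventually_atTop.1 (h1.eventually (lt_mem_nhds hlt))
  have hG : Antitone fun t : ℝ => P.real {ω | t < ‖X ω‖} :=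
    fun s t hst => measureReal_mono fun ω hω => hst.trans_lt hω
  have hdouble : ∀ t, max t₁ 1 ≤ t →
      P.real {ω | t < ‖X ω‖} ≤ 2 ^ (α + δ) * P.real {ω | 2 * t < ‖X ω‖} := by
    intro t ht
    have h2 := ht₁ t ((le_max_left _ _).trans ht)
    rw [lt_div_iff₀ (h.tail_pos t), Real.rpow_neg zero_le_two, inv_mul_lt_iff₀ (by positivity),
      mul_comm t 2] at h2
    exact h2.le
  refine ⟨(P.real {ω | max t₁ 1 < ‖X ω‖})⁻¹ * 2 ^ (α + δ), max t₁ 1, by positivity,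
    fun s t hs ht => ?_⟩
  exact potter_bound hG h.tail_pos (fun _ => measureReal_le_one) (add_pos h.1 hδ)
    (lt_max_of_lt_right one_pos) hdouble hs ht

open Topology in
/-- Convergence of the tails of linear functionals along convergent coefficients. -/
lemma IsRegVarVec.tendsto_inner_tail {Ω : Type*} [MeasurableSpace Ω] {d : ℕ} {P : Measure Ω}
    [IsProbabilityMeasure P]
    {X : Ω → EuclideanSpace ℝ (Fin d)} {α : ℝ} {μ : Measure (EuclideanSpace ℝ (Fin d))}
    (h : IsRegVarVec P X α μ) {a : ℕ → EuclideanSpace ℝ (Fin d)} {b : EuclideanSpace ℝ (Fin d)}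
    (hab : Tendsto a atTop (𝓝 b)) {lam : ℕ → ℝ} (hlam : Tendsto lam atTop atTop)
    {x : ℝ} (hx : 0 < x) :
    Tendsto (fun n => P.real {ω | lam n * x < inner ℝ (a n) (X ω)} / P.real {ω | lam n < ‖X ω‖})
      atTop (𝓝 (x ^ (-α) * μ.real {z | 1 < inner ℝ b z})) := by
  have hlin : ∀ c : ℝ, 0 < c → Tendsto
      (fun n => P.real {ω | lam n * c < inner ℝ b (X ω)} / P.real {ω | lam n < ‖X ω‖})
      atTop (𝓝 (c ^ (-α) * μ.real {z | 1 < inner ℝ b z})) := fun c hc =>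
    (h.tendsto_tail (f := fun z => inner ℝ b z) (by fun_prop)
      (fun t _ z => by rw [real_inner_smul_right]) hc).comp hlam
  have hnorm : ∀ c : ℝ, 0 < c → Tendsto
      (fun n => P.real {ω | lam n * c < ‖X ω‖} / P.real {ω | lam n < ‖X ω‖})
      atTop (𝓝 (c ^ (-α))) := fun c hc => (h.tendsto_norm_tail hc).comp hlam
  set m := μ.real {z | 1 < inner ℝ b z}
  have hdist : ∀ ε M : ℝ, 0 < ε → 0 < M → ∀ᶠ n in atTop, 0 < lam n ∧ ∀ ω,
      ‖X ω‖ ≤ lam n * M → |inner ℝ (a n) (X ω) - inner ℝ b (X ω)| ≤ lam n * ε := by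
    intro ε M hε hM
    have h1 : Tendsto (fun n => ‖a n - b‖) atTop (𝓝 0) := by
      simpa using (hab.sub_const b).norm
    filter_upwards [h1.eventually (gt_mem_nhds (div_pos hε hM)), hlam.eventually_gt_atTop 0]
      with n hn hl
    refine ⟨hl, fun ω hω => ?_⟩
    rw [← inner_sub_left]
    calc |inner ℝ (a n - b) (X ω)| ≤ ‖a n - b‖ * ‖X ω‖ := abs_real_inner_le_norm _ _
      _ ≤ ε / M * (lam n * M) := by gcongr
      _ = lam n * ε := by field_simp
  have hMlim : Tendsto (fun M : ℝ => M ^ (-α)) atTop (𝓝 0) := tendsto_rpow_neg_atTop h.1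
  have hclim : Tendsto (fun c : ℝ => c ^ (-α) * m) (𝓝 x) (𝓝 (x ^ (-α) * m)) :=
    (Real.continuousAt_rpow_const x (-α) (Or.inl hx.ne')).mul_const m
  refine tendsto_order.2 ⟨fun y hy => ?_, fun y hy => ?_⟩
  · have hr : ∀ᶠ c in 𝓝[>] x, (y + x ^ (-α) * m) / 2 < c ^ (-α) * m :=
      (tendsto_nhdsWithin_of_tendsto_nhds hclim).eventually (lt_mem_nhds (by linarith))
    obtain ⟨c, hc, hxc⟩ := (hr.and self_mem_nhdsWithin).exists
    replace hxc : x < c := hxc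
    obtain ⟨M, hM, hM0⟩ := ((hMlim.eventually (gt_mem_nhds
      (show 0 < (x ^ (-α) * m - y) / 2 by linarith))).and (eventually_gt_atTop 0)).exists
    have hsub := (hlin c (hx.trans hxc)).sub (hnorm M hM0)
    filter_upwards [hsub.eventually (lt_mem_nhds (show y < c ^ (-α) * m - M ^ (-α) by linarith)),
      hdist (c - x) M (sub_pos.2 hxc) hM0] with n hn hd
    refine hn.trans_le ?_
    rw [← sub_div]
    refine div_le_div_of_nonneg_right ?_ measureReal_nonneg
    rw [sub_le_iff_le_add]
    refine (measureReal_mono fun ω hω => ?_).trans (measureReal_union_le _ _)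
    rw [Set.mem_ofPred_eq] at hω
    rcases le_or_gt (‖X ω‖) (lam n * M) with hXM | hXM
    · left
      have := abs_le.1 (hd.2 ω hXM)
      rw [Set.mem_ofPred_eq]
      nlinarith
    · exact Or.inr hXM
  · have hr : ∀ᶠ c in 𝓝[<] x, c ^ (-α) * m < (y + x ^ (-α) * m) / 2 :=
      (tendsto_nhdsWithin_of_tendsto_nhds hclim).eventually (gt_mem_nhds (by linarith))
    obtain ⟨c, hc, hc0, hxc⟩ := (hr.and (Ioo_mem_nhdsLT hx)).exists
    obtain ⟨M, hM, hM0⟩ := ((hMlim.eventually (gt_mem_nhds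
      (show 0 < (y - x ^ (-α) * m) / 2 by linarith))).and (eventually_gt_atTop 0)).exists
    have hadd := (hlin c hc0).add (hnorm M hM0)
    filter_upwards [hadd.eventually (gt_mem_nhds (show c ^ (-α) * m + M ^ (-α) < y by linarith)),
      hdist (x - c) M (sub_pos.2 hxc) hM0] with n hn hd
    refine lt_of_le_of_lt ?_ hn
    rw [← add_div]
    refine div_le_div_of_nonneg_right ?_ measureReal_nonneg
    refine (measureReal_mono fun ω hω => ?_).trans (measureReal_union_le _ _)
    rw [Set.mem_ofPred_eq] at hω
    rcases le_or_gt (‖X ω‖) (lam n * M) with hXM | hXM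
    · left
      have := abs_le.1 (hd.2 ω hXM)
      rw [Set.mem_ofPred_eq]
      nlinarith
    · exact Or.inr hXM

/-- The probability that an inner product of independent vectors exceeds a level, computed by
conditioning on one factor. -/
lemma measureReal_inner_gt_eq_integral {Ω E : Type*} [MeasurableSpace Ω] {P : Measure Ω}
    [IsProbabilityMeasure P] [NormedAddCommGroup E] [InnerProductSpace ℝ E] [MeasurableSpace E]
    [BorelSpace E] [SecondCountableTopology E] {A X : Ω → E} (hA : Measurable A)
    (hX : Measurable X) (hAX : IndepFun A X P) (c : ℝ) :
    Measurable (fun ω => P.real {ω' | c < inner ℝ (A ω) (X ω')}) ∧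
    P.real {ω | c < inner ℝ (A ω) (X ω)} = ∫ ω, P.real {ω' | c < inner ℝ (A ω) (X ω')} ∂P := by
  have hS : MeasurableSet {p : E × E | c < inner ℝ p.1 p.2} :=
    measurableSet_lt measurable_const (measurable_fst.inner measurable_snd)
  have : IsProbabilityMeasure (P.map X) := Measure.isProbabilityMeasure_map hX.aemeasurable
  have : IsProbabilityMeasure (P.map A) := Measure.isProbabilityMeasure_map hA.aemeasurable
  have hmeas := measurable_measure_prodMk_left (ν := P.map X) hS
  have hsec : ∀ a, P.map X (Prod.mk a ⁻¹' {p : E × E | c < inner ℝ p.1 p.2})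
      = P {ω' | c < inner ℝ a (X ω')} := fun a => by
    rw [Measure.map_apply hX (measurable_prodMk_left hS)]
    rfl
  simp only [hsec] at hmeas
  have hmeasA : Measurable (fun ω => P {ω' | c < inner ℝ (A ω) (X ω')}) := hmeas.comp hA
  refine ⟨hmeasA.ennreal_toReal, ?_⟩
  simp only [Measure.real]
  rw [integral_toReal hmeasA.aemeasurable (ae_of_all _ fun _ => measure_lt_top _ _)]
  congr 1
  have h1 : P {ω | c < inner ℝ (A ω) (X ω)}
      = P.map (fun ω => (A ω, X ω)) {p : E × E | c < inner ℝ p.1 p.2} := by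
    rw [Measure.map_apply (hA.prodMk hX) hS]
    rfl
  rw [h1, (indepFun_iff_map_prod_eq_prod_map_map hA.aemeasurable hX.aemeasurable).1 hAX,
    Measure.prod_apply hS]
  simp only [hsec]
  rw [lintegral_map hmeas hA]

/-- Lemma 1 of Djehiche–Svensson: if `X ∈ RV(α, μ)` and `A_n` are random vectors,
each nonzero and independent of `X`, with `A_n → A ≠ 0` a.s. and
`E (sup_n ‖A_n‖)^{α+δ} < ∞`, then for `0 < λ_n ↑ ∞` and `x > 0`,
`P(A_n ⬝ X > λ_n x) / P(‖X‖ > λ_n) → x^{-α} E[μ {z | A ⬝ z > 1}]`. -/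
theorem random_coefficient_regular_variation_limit
    {Ω : Type*} [MeasurableSpace Ω] (P : Measure Ω) [IsProbabilityMeasure P]
    {d : ℕ} (X : Ω → EuclideanSpace ℝ (Fin d)) (hXmeas : Measurable X)
    (α : ℝ) (μ : Measure (EuclideanSpace ℝ (Fin d)))
    (hRVX : IsRegVarVec P X α μ)
    (A : ℕ → Ω → EuclideanSpace ℝ (Fin d)) (hAmeas : ∀ n, Measurable (A n))
    (hAne : ∀ n, ∀ᵐ ω ∂P, A n ω ≠ 0)
    (hAindep : ∀ n, IndepFun (A n) X P)
    (Alim : Ω → EuclideanSpace ℝ (Fin d))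
    (hconv : ∀ᵐ ω ∂P, Tendsto (fun n => A n ω) atTop (nhds (Alim ω)) ∧ Alim ω ≠ 0)
    (δ : ℝ) (hδ : 0 < δ)
    (hmom : Integrable (fun ω => (⨆ n, ‖A n ω‖) ^ (α + δ)) P)
    (lam : ℕ → ℝ) (hlampos : ∀ n, 0 < lam n) (hlammono : Monotone lam)
    (hlamtop : Tendsto lam atTop atTop)
    (x : ℝ) (hx : 0 < x) :
    Tendsto (fun n : ℕ =>
        (P {ω | lam n * x < ∑ j, A n ω j * X ω j}).toReal
          / (P {ω | lam n < ‖X ω‖}).toReal)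
      atTop
      (nhds (x ^ (-α) * ∫ ω, (μ {z | 1 < ∑ j, Alim ω j * z j}).toReal ∂P)) := by
  have hinner : ∀ a z : EuclideanSpace ℝ (Fin d), ∑ j, a j * z j = inner ℝ a z := by
    intro a z
    simp [PiLp.inner_apply, mul_comm]
  simp only [hinner]
  change Tendsto (fun n : ℕ => P.real {ω | lam n * x < inner ℝ (A n ω) (X ω)}
    / P.real {ω | lam n < ‖X ω‖}) atTop
    (nhds (x ^ (-α) * ∫ ω, μ.real {z | 1 < inner ℝ (Alim ω) z} ∂P))
  rw [← integral_const_mul]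
  obtain ⟨C, t₀, hC, hpotter⟩ := hRVX.exists_potter_bound hδ
  have hβ : 0 < α + δ := add_pos hRVX.1 hδ
  set S : Ω → ℝ := fun ω => ⨆ n, ‖A n ω‖
  have hcond := fun n => measureReal_inner_gt_eq_integral (hAmeas n) hXmeas (hAindep n) (lam n * x)
  simp only [fun n => (hcond n).2, ← integral_div]
  refine tendsto_integral_filter_of_dominated_convergence
    (fun ω => C * (1 + x⁻¹ ^ (α + δ) * S ω ^ (α + δ))) ?_ ?_ ?_ ?_
  · exact Eventually.of_forall fun n => ((hcond n).1.div_const _).aestronglyMeasurable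
  · filter_upwards [hlamtop.eventually_ge_atTop t₀] with n hn
    filter_upwards [hconv] with ω hω
    have hAS : ‖A n ω‖ ≤ S ω := le_ciSup hω.1.norm.bddAbove_range n
    have hS0 : 0 ≤ S ω := (norm_nonneg _).trans hAS
    have hs : 1 ≤ max 1 (x⁻¹ * S ω) := le_max_left _ _
    rw [Real.norm_of_nonneg (div_nonneg measureReal_nonneg measureReal_nonneg),
      div_le_iff₀ (hRVX.tail_pos _)]
    calc P.real {ω' | lam n * x < inner ℝ (A n ω) (X ω')}
        ≤ P.real {ω' | lam n / max 1 (x⁻¹ * S ω) < ‖X ω'‖} := by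
          refine measureReal_mono fun ω' hω' => ?_
          rw [Set.mem_ofPred_eq] at hω' ⊢
          rw [div_lt_iff₀ (by linarith), ← mul_lt_mul_iff_left₀ hx]
          calc lam n * x < inner ℝ (A n ω) (X ω') := hω'
            _ ≤ ‖A n ω‖ * ‖X ω'‖ := real_inner_le_norm _ _
            _ ≤ S ω * ‖X ω'‖ := by gcongr
            _ = ‖X ω'‖ * (x⁻¹ * S ω) * x := by field_simp
            _ ≤ ‖X ω'‖ * max 1 (x⁻¹ * S ω) * x := by
              gcongr
              exact le_max_right _ _
      _ ≤ C * max 1 (x⁻¹ * S ω) ^ (α + δ) * P.real {ω' | lam n < ‖X ω'‖} := hpotter _ _ hs hn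
      _ ≤ C * (1 + x⁻¹ ^ (α + δ) * S ω ^ (α + δ)) * P.real {ω' | lam n < ‖X ω'‖} := by
        gcongr
        rw [← Real.mul_rpow (by positivity) hS0]
        rcases max_cases 1 (x⁻¹ * S ω) with h | h
        · rw [h.1, Real.one_rpow]
          exact le_add_of_nonneg_right (by positivity)
        · rw [h.1]
          exact le_add_of_nonneg_left zero_le_one
  · exact ((integrable_const 1).add (hmom.const_mul _)).const_mul C
  · filter_upwards [hconv] with ω hω
    exact hRVX.tendsto_inner_tail hω.1 hlamtop hx
end
end

section
/- (Multivariate Breiman lemma.) Let X be a regularly varying random vector in ℝ^d, X ∈ RV(α, μ), and let A be a random k × d matrix independent of X with 0 < E[|A|_∞^{α + δ}] < ∞ for some δ > 0, where |A|_∞ = sup_{|x| = 1} |A x| is the operator norm. Then for every Borel set B ⊆ ℝ^k with 0 ∉ closure(B) and E[μ(A^{-1}(∂B))] = 0, one has P(A X ∈ xB) / P(|X| > x) → E[μ(A^{-1}(B))] as x → ∞, where A^{-1}(B) = {z ∈ ℝ^d : A z ∈ B}. -/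
open MeasureTheory ProbabilityTheory Filter Finset Pointwise

noncomputable section

/-- Multivariate Breiman lemma (Basrak–Davis–Mikosch): if `X ∈ RV(α, μ)` in `ℝ^d` and `A`
is a random `k × d` matrix independent of `X` with `0 < E ‖A‖_op^{α+δ} < ∞`, then for every
Borel `B ⊆ ℝ^k` bounded away from `0` with `E[μ(A⁻¹(∂B))] = 0`,
`P(A X ∈ x B) / P(‖X‖ > x) → E[μ(A⁻¹(B))]` as `x → ∞`. -/
instance {k d : ℕ} : MeasurableSpace (Matrix (Fin k) (Fin d) ℝ) :=
  inferInstanceAs (MeasurableSpace (Fin k → Fin d → ℝ))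

theorem smul_setOf_lt_norm {d : ℕ} {x : ℝ} (hx : 0 < x) (t : ℝ) :
    x • {z : EuclideanSpace ℝ (Fin d) | t < ‖z‖} = {z | x * t < ‖z‖} := by
  ext z
  rw [Set.mem_smul_set_iff_inv_smul_mem₀ hx.ne']
  simp only [Set.mem_ofPred_eq, norm_smul, norm_inv, Real.norm_eq_abs, abs_of_pos hx]
  rw [lt_inv_mul_iff₀ hx]

theorem measurableSet_lt_norm {d : ℕ} (t : ℝ) :
    MeasurableSet {z : EuclideanSpace ℝ (Fin d) | t < ‖z‖} :=
  measurableSet_lt measurable_const measurable_norm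

theorem zero_notMem_closure_lt_norm {d : ℕ} {t : ℝ} (ht : 0 < t) :
    (0 : EuclideanSpace ℝ (Fin d)) ∉ closure {z : EuclideanSpace ℝ (Fin d) | t < ‖z‖} := by
  intro h
  have := closure_lt_subset_le continuous_const continuous_norm h
  simp only [Set.mem_ofPred_eq, norm_zero] at this
  linarith

namespace IsRegVarVec

variable {Ω : Type*} [MeasurableSpace Ω] {d : ℕ} {P : Measure Ω}
  {X : Ω → EuclideanSpace ℝ (Fin d)} {α : ℝ} {μ : Measure (EuclideanSpace ℝ (Fin d))}

theorem measure_lt_norm (h : IsRegVarVec P X α μ) {t : ℝ} (ht : 0 < t) :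
    μ {z | t < ‖z‖} = ENNReal.ofReal (t ^ (-α)) := by
  obtain ⟨-, -, -, hhom, hnorm, -⟩ := h
  have := hhom t ht _ (measurableSet_lt_norm 1)
  rwa [smul_setOf_lt_norm ht, hnorm, mul_one, mul_one] at this

theorem measure_one_eq_norm (h : IsRegVarVec P X α μ) : μ {z | (1 : ℝ) = ‖z‖} = 0 := by
  have hle : μ {z | (1 : ℝ) ≤ ‖z‖} ≤ 1 := by
    have hlim : Tendsto (fun t : ℝ => ENNReal.ofReal (t ^ (-α))) (nhdsWithin 1 (Set.Iio 1))
        (nhds 1) := by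
      have hc : ContinuousAt (fun t : ℝ => t ^ (-α)) 1 :=
        Real.continuousAt_rpow_const _ _ (Or.inl one_ne_zero)
      have := (ENNReal.continuous_ofReal.tendsto _).comp hc.tendsto
      simp only [Real.one_rpow, ENNReal.ofReal_one] at this
      exact this.mono_left nhdsWithin_le_nhds
    refine ge_of_tendsto hlim ?_
    filter_upwards [Ioo_mem_nhdsLT (zero_lt_one' ℝ)] with t ht
    rw [← h.measure_lt_norm ht.1]
    exact measure_mono fun z (hz : (1 : ℝ) ≤ ‖z‖) => lt_of_lt_of_le ht.2 hz
  have heq : {z : EuclideanSpace ℝ (Fin d) | (1 : ℝ) = ‖z‖} =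
      {z | (1 : ℝ) ≤ ‖z‖} \ {z | (1 : ℝ) < ‖z‖} := by
    ext z
    simp only [Set.mem_ofPred_eq, Set.mem_sdiff, not_lt]
    exact ⟨fun h => ⟨h.le, h.ge⟩, fun h => le_antisymm h.1 h.2⟩
  have hone : μ {z | (1 : ℝ) < ‖z‖} = 1 := by simpa using h.measure_lt_norm one_pos
  have hsub : {z : EuclideanSpace ℝ (Fin d) | (1 : ℝ) < ‖z‖} ⊆ {z | (1 : ℝ) ≤ ‖z‖} :=
    fun z (hz : (1 : ℝ) < ‖z‖) => hz.le
  rw [heq, measure_sdiff hsub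
    (measurableSet_lt_norm 1).nullMeasurableSet (by simp [hone]), hone]
  exact tsub_eq_zero_of_le hle

theorem measure_frontier_lt_norm (h : IsRegVarVec P X α μ) {t : ℝ} (ht : 0 < t) :
    μ (frontier {z | t < ‖z‖}) = 0 := by
  refine measure_mono_null (frontier_lt_subset_eq continuous_const continuous_norm) ?_
  have heq : {z : EuclideanSpace ℝ (Fin d) | t = ‖z‖} = t • {z | (1 : ℝ) = ‖z‖} := by
    ext z
    rw [Set.mem_smul_set_iff_inv_smul_mem₀ ht.ne']
    simp only [Set.mem_ofPred_eq, norm_smul, norm_inv, Real.norm_eq_abs, abs_of_pos ht]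
    rw [eq_inv_mul_iff_mul_eq₀ ht.ne', mul_one]
  rw [heq, h.2.2.2.1 t ht _ (measurableSet_eq_fun measurable_const measurable_norm),
    h.measure_one_eq_norm, mul_zero]

theorem tendsto_tail_ratio (h : IsRegVarVec P X α μ) {t : ℝ} (ht : 0 < t) :
    Tendsto (fun x : ℝ => P.real {ω | x * t < ‖X ω‖} / P.real {ω | x < ‖X ω‖}) atTop
      (nhds (t ^ (-α))) := by
  have := h.2.2.2.2.2 _ (measurableSet_lt_norm t) (zero_notMem_closure_lt_norm ht)
    (h.measure_frontier_lt_norm ht)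
  rw [h.measure_lt_norm ht, ENNReal.toReal_ofReal (by positivity)] at this
  refine this.congr' ?_
  filter_upwards [eventually_gt_atTop 0] with x hx
  rw [smul_setOf_lt_norm hx]
  rfl

theorem eventually_tail_pos (h : IsRegVarVec P X α μ) :
    ∀ᶠ x : ℝ in atTop, 0 < P.real {ω | x < ‖X ω‖} := by
  have := h.tendsto_tail_ratio one_pos
  rw [Real.one_rpow] at this
  filter_upwards [this.eventually_ne one_ne_zero] with x hx
  exact lt_of_le_of_ne measureReal_nonneg fun h0 => hx (by rw [← h0, div_zero])

/-- A Potter-type bound for the tail of `‖X‖` along powers of two. -/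
theorem exists_tail_div_two_pow_le [IsProbabilityMeasure P] (h : IsRegVarVec P X α μ)
    {β : ℝ} (hβ : α < β) :
    ∃ C > 0, ∃ x₀ > 0, ∀ (n : ℕ) (x : ℝ), x₀ ≤ x → 0 < P.real {ω | x < ‖X ω‖} ∧
      P.real {ω | x / 2 ^ n < ‖X ω‖} ≤ C * ((2 : ℝ) ^ n) ^ β * P.real {ω | x < ‖X ω‖} := by
  have hlt : (2 : ℝ) ^ (-β) < 2 ^ (-α) :=
    Real.rpow_lt_rpow_of_exponent_lt one_lt_two (neg_lt_neg hβ)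
  obtain ⟨x₁, hx₁⟩ := eventually_atTop.1 (h.eventually_tail_pos.and
    ((h.tendsto_tail_ratio two_pos).eventually_const_lt hlt))
  set T : ℝ → ℝ := fun x => P.real {ω | x < ‖X ω‖} with hT
  have hanti : Antitone T := fun a b hab =>
    measureReal_mono fun ω (hω : b < ‖X ω‖) => lt_of_le_of_lt hab hω
  have hT1 : ∀ x, T x ≤ 1 := fun x => measureReal_le_one
  set x₀ := max x₁ 1 with hx₀
  have hpos : ∀ x, x₀ ≤ x → 0 < T x := fun x hx => (hx₁ x ((le_max_left _ _).trans hx)).1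
  have hβ2 : (0 : ℝ) < 2 ^ β := by positivity
  have hdouble : ∀ x, x₀ ≤ x → T x ≤ 2 ^ β * T (x * 2) := by
    intro x hx
    have := (hx₁ x ((le_max_left _ _).trans hx)).2
    rw [lt_div_iff₀ (hpos x hx), Real.rpow_neg two_pos.le, inv_mul_lt_iff₀ hβ2] at this
    exact this.le
  have h0 := hpos x₀ le_rfl
  have hx₀pos : 0 < x₀ := lt_of_lt_of_le one_pos (le_max_right _ _)
  refine ⟨(T x₀)⁻¹, inv_pos.2 h0, x₀, hx₀pos, fun n x hx => ⟨hpos x hx, ?_⟩⟩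
  change T (x / 2 ^ n) ≤ (T x₀)⁻¹ * ((2 : ℝ) ^ n) ^ β * T x
  induction n generalizing x with
  | zero =>
    simp only [pow_zero, div_one, Real.one_rpow, mul_one]
    exact le_mul_of_one_le_left (hpos x hx).le ((one_le_inv₀ h0).2 (hT1 _))
  | succ n ih =>
    rw [pow_succ, Real.mul_rpow (by positivity) two_pos.le]
    rcases le_or_gt x₀ (x / 2) with hx2 | hx2
    · have h1 := ih (x / 2) hx2
      have h2 := hdouble (x / 2) hx2
      rw [div_mul_cancel₀ _ two_ne_zero] at h2
      rw [div_div, mul_comm 2] at h1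
      calc T (x / (2 ^ n * 2)) ≤ (T x₀)⁻¹ * ((2 : ℝ) ^ n) ^ β * T (x / 2) := h1
        _ ≤ (T x₀)⁻¹ * ((2 : ℝ) ^ n) ^ β * (2 ^ β * T x) := by gcongr
        _ = _ := by ring
    · have h2 : T x₀ ≤ 2 ^ β * T x :=
        (hdouble x₀ le_rfl).trans (by gcongr; exact hanti (by linarith))
      have hge : (1 : ℝ) ≤ ((2 : ℝ) ^ n) ^ β :=
        Real.one_le_rpow (one_le_pow₀ one_le_two) (h.1.trans hβ).le
      calc T (x / (2 ^ n * 2)) ≤ 1 := hT1 _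
        _ = (T x₀)⁻¹ * 1 * T x₀ := by rw [mul_one, inv_mul_cancel₀ h0.ne']
        _ ≤ (T x₀)⁻¹ * ((2 : ℝ) ^ n) ^ β * (2 ^ β * T x) := by gcongr
        _ = _ := by ring

/-- A Potter-type bound for the tail of `‖X‖`. -/
theorem exists_tail_div_le [IsProbabilityMeasure P] (h : IsRegVarVec P X α μ)
    {β : ℝ} (hβ : α < β) :
    ∃ C > 0, ∃ x₀ > 0, ∀ x : ℝ, x₀ ≤ x → 0 < P.real {ω | x < ‖X ω‖} ∧ ∀ c : ℝ, 1 ≤ c →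
      P.real {ω | x / c < ‖X ω‖} ≤ C * c ^ β * P.real {ω | x < ‖X ω‖} := by
  obtain ⟨C, hC, x₀, hx₀, hbd⟩ := h.exists_tail_div_two_pow_le hβ
  refine ⟨C * 2 ^ β, by positivity, x₀, hx₀, fun x hx => ⟨(hbd 0 x hx).1, fun c hc => ?_⟩⟩
  obtain ⟨n, hn, hn'⟩ := exists_nat_pow_near hc one_lt_two
  have hβ0 : 0 ≤ β := (h.1.trans hβ).le
  have hxpos : 0 < x := hx₀.trans_le hx
  calc P.real {ω | x / c < ‖X ω‖} ≤ P.real {ω | x / 2 ^ (n + 1) < ‖X ω‖} :=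
        measureReal_mono fun ω (hω : x / c < ‖X ω‖) => lt_of_le_of_lt
          (div_le_div_of_nonneg_left hxpos.le (by positivity) hn'.le) hω
    _ ≤ C * ((2 : ℝ) ^ (n + 1)) ^ β * P.real {ω | x < ‖X ω‖} := (hbd (n + 1) x hx).2
    _ ≤ C * (2 * c) ^ β * P.real {ω | x < ‖X ω‖} := by
        gcongr
        rw [pow_succ, mul_comm]
        gcongr
    _ = _ := by rw [Real.mul_rpow two_pos.le (by positivity)]; ring

theorem sigmaFinite_restrict (h : IsRegVarVec P X α μ) : SigmaFinite (μ.restrict {0}ᶜ) := by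
  refine ⟨⟨{ set := fun n => {z | (1 / ((n : ℝ) + 1)) < ‖z‖} ∪ {0}
             set_mem := fun _ => trivial
             finite := fun n => ?_
             spanning := ?_ }⟩⟩
  · have hn : (0 : ℝ) < 1 / ((n : ℝ) + 1) := by positivity
    refine (measure_union_le _ _).trans_lt (ENNReal.add_lt_top.2 ⟨?_, ?_⟩)
    · refine (Measure.restrict_apply_le _ _).trans_lt ?_
      rw [h.measure_lt_norm hn]
      exact ENNReal.ofReal_lt_top
    · rw [Measure.restrict_apply (measurableSet_singleton 0)]
      simp
  · refine Set.eq_univ_of_forall fun z => Set.mem_iUnion.2 ?_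
    by_cases hz : z = 0
    · exact ⟨0, Or.inr hz⟩
    · obtain ⟨n, hn⟩ := exists_nat_one_div_lt (norm_pos_iff.2 hz)
      exact ⟨n, Or.inl hn⟩

end IsRegVarVec

theorem measurable_toEuclideanLin_apply {d k : ℕ} :
    Measurable fun p : Matrix (Fin k) (Fin d) ℝ × EuclideanSpace ℝ (Fin d) =>
      Matrix.toEuclideanLin p.1 p.2 := by
  have hentry : ∀ i j, Measurable fun p : Matrix (Fin k) (Fin d) ℝ × EuclideanSpace ℝ (Fin d) =>
      p.1 i j := fun i j =>
    (measurable_pi_apply j).comp ((measurable_pi_apply i).comp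
      (measurable_fst (α := Fin k → Fin d → ℝ)))
  have hcoord : ∀ j, Measurable fun p : Matrix (Fin k) (Fin d) ℝ × EuclideanSpace ℝ (Fin d) =>
      p.2 j := fun j => by fun_prop
  refine (MeasurableEquiv.toLp 2 (Fin k → ℝ)).measurable.comp (measurable_pi_lambda _ fun i => ?_)
  change Measurable fun p : Matrix (Fin k) (Fin d) ℝ × EuclideanSpace ℝ (Fin d) =>
    ∑ j, p.1 i j * p.2 j
  exact Finset.measurable_sum _ fun j _ => (hentry i j).mul (hcoord j)

theorem multivariate_breiman
    {Ω : Type*} [MeasurableSpace Ω] (P : Measure Ω) [IsProbabilityMeasure P]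
    {d k : ℕ} (X : Ω → EuclideanSpace ℝ (Fin d)) (hXmeas : Measurable X)
    (α : ℝ) (μ : Measure (EuclideanSpace ℝ (Fin d)))
    (hRVX : IsRegVarVec P X α μ)
    (A : Ω → Matrix (Fin k) (Fin d) ℝ) (hAmeas : Measurable A)
    (hindep : IndepFun A X P)
    (δ : ℝ) (hδ : 0 < δ)
    (hmom : Integrable (fun ω =>
      ‖LinearMap.toContinuousLinearMap (Matrix.toEuclideanLin (A ω))‖ ^ (α + δ)) P)
    (hmompos : 0 < ∫ ω,
      ‖LinearMap.toContinuousLinearMap (Matrix.toEuclideanLin (A ω))‖ ^ (α + δ) ∂P)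
    (B : Set (EuclideanSpace ℝ (Fin k))) (hBmeas : MeasurableSet B)
    (hB0 : (0 : EuclideanSpace ℝ (Fin k)) ∉ closure B)
    (hBfrontier : ∫⁻ ω, μ (⇑(Matrix.toEuclideanLin (A ω)) ⁻¹' frontier B) ∂P = 0) :
    Tendsto (fun x : ℝ =>
        (P {ω | Matrix.toEuclideanLin (A ω) (X ω) ∈ x • B}).toReal
          / (P {ω | x < ‖X ω‖}).toReal)
      atTop
      (nhds (∫ ω, (μ (⇑(Matrix.toEuclideanLin (A ω)) ⁻¹' B)).toReal ∂P)) := by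
  set L : Ω → EuclideanSpace ℝ (Fin d) →L[ℝ] EuclideanSpace ℝ (Fin k) := fun ω =>
    LinearMap.toContinuousLinearMap (Matrix.toEuclideanLin (A ω)) with hL
  have hLapp : ∀ ω z, Matrix.toEuclideanLin (A ω) z = L ω z := fun ω z => rfl
  obtain ⟨C, hC, x₀, hx₀, hpotter⟩ := hRVX.exists_tail_div_le (lt_add_of_pos_right α hδ)
  have hβ : 0 < α + δ := add_pos hRVX.1 hδ
  obtain ⟨r, hr, hball⟩ := Metric.isOpen_iff.1 isClosed_closure.isOpen_compl _ hB0
  have hrB : ∀ y ∈ B, r ≤ ‖y‖ := fun y hy => by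
    by_contra! hlt
    exact hball (mem_ball_zero_iff.2 hlt) (subset_closure hy)
  -- the joint law factorizes
  have hset : ∀ S : Set (EuclideanSpace ℝ (Fin k)), MeasurableSet S →
      MeasurableSet {p : Matrix (Fin k) (Fin d) ℝ × EuclideanSpace ℝ (Fin d) |
        Matrix.toEuclideanLin p.1 p.2 ∈ S} := fun S hS => measurable_toEuclideanLin_apply hS
  have hsec : ∀ S : Set (EuclideanSpace ℝ (Fin k)), MeasurableSet S →
      Measurable fun ω => P (X ⁻¹' {z | L ω z ∈ S}) := fun S hS => by
    have : IsProbabilityMeasure (P.map X) := Measure.isProbabilityMeasure_map hXmeas.aemeasurable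
    convert (measurable_measure_prodMk_left (ν := P.map X) (hset S hS)).comp hAmeas using 1
    ext1 ω
    symm
    exact Measure.map_apply hXmeas ((L ω).continuous.measurable hS)
  have hfact : ∀ S : Set (EuclideanSpace ℝ (Fin k)), MeasurableSet S →
      P {ω | Matrix.toEuclideanLin (A ω) (X ω) ∈ S} = ∫⁻ ω, P (X ⁻¹' {z | L ω z ∈ S}) ∂P := by
    intro S hS
    have : IsProbabilityMeasure (P.map X) := Measure.isProbabilityMeasure_map hXmeas.aemeasurable
    have h1 := congrArg (fun m => m {p : Matrix (Fin k) (Fin d) ℝ × EuclideanSpace ℝ (Fin d) |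
        Matrix.toEuclideanLin p.1 p.2 ∈ S})
      ((indepFun_iff_map_prod_eq_prod_map_map hAmeas.aemeasurable hXmeas.aemeasurable).1 hindep)
    rw [Measure.map_apply (hAmeas.prodMk hXmeas) (hset S hS), Measure.prod_apply (hset S hS),
      lintegral_map (measurable_measure_prodMk_left (hset S hS)) hAmeas] at h1
    refine h1.trans (lintegral_congr fun ω => ?_)
    exact Measure.map_apply hXmeas ((L ω).continuous.measurable hS)
  have hreal : ∀ x : ℝ, 0 < x → (P {ω | Matrix.toEuclideanLin (A ω) (X ω) ∈ x • B}).toReal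
      / (P {ω | x < ‖X ω‖}).toReal =
      ∫ ω, (P (X ⁻¹' {z | L ω z ∈ x • B})).toReal / (P {ω | x < ‖X ω‖}).toReal ∂P := by
    intro x hx
    have hxB : MeasurableSet (x • B) := hBmeas.const_smul₀ x
    rw [integral_div, hfact _ hxB, integral_toReal (hsec _ hxB).aemeasurable
      (ae_of_all _ fun _ => measure_lt_top _ _)]
  -- the boundaries of almost all preimages are null
  have hfr : ∀ᵐ ω ∂P, μ (L ω ⁻¹' frontier B) = 0 := by
    have : SigmaFinite (μ.restrict {0}ᶜ) := hRVX.sigmaFinite_restrict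
    have hmeas : Measurable fun ω => μ (L ω ⁻¹' frontier B) := by
      convert (measurable_measure_prodMk_left (ν := μ.restrict {0}ᶜ)
        (hset _ (isClosed_frontier (s := B)).measurableSet)).comp hAmeas using 1
      ext1 ω
      symm
      refine Measure.restrict_eq_self _ fun z hz hz0 => hB0 ?_
      have hz' : L ω z ∈ frontier B := hz
      rw [Set.mem_singleton_iff.1 hz0, map_zero] at hz'
      exact frontier_subset_closure hz'
    exact (lintegral_eq_zero_iff hmeas).1 hBfrontier
  refine Tendsto.congr' (f₁ := fun x : ℝ => ∫ ω, (P (X ⁻¹' {z | L ω z ∈ x • B})).toReal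
    / (P {ω | x < ‖X ω‖}).toReal ∂P) ?_ ?_
  · filter_upwards [eventually_gt_atTop 0] with x hx using (hreal x hx).symm
  refine tendsto_integral_filter_of_dominated_convergence
    (fun ω => C * (1 + ‖L ω‖ ^ (α + δ) / r ^ (α + δ) * 2 ^ (α + δ))) ?_ ?_ ?_ ?_
  · filter_upwards with x
    exact ((hsec _ (hBmeas.const_smul₀ x)).ennreal_toReal.div_const _).aestronglyMeasurable
  · filter_upwards [eventually_ge_atTop x₀] with x hx
    refine ae_of_all _ fun ω => ?_
    have hxpos : 0 < x := hx₀.trans_le hx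
    obtain ⟨hpos, hbd⟩ := hpotter x hx
    rw [Real.norm_of_nonneg (by positivity)]
    refine (div_le_iff₀ hpos).2 ?_
    set c := max 1 (‖L ω‖ / r * 2) with hc
    have hc1 : 1 ≤ c := le_max_left _ _
    have hsub : X ⁻¹' {z | L ω z ∈ x • B} ⊆ {ω' | x / c < ‖X ω'‖} := by
      rintro ω' ⟨y, hy, hyx⟩
      have hyx' : x * ‖y‖ = ‖L ω (X ω')‖ := by
        rw [← hyx]
        simp [norm_smul, abs_of_pos hxpos]
      have h1 : x * r ≤ ‖L ω‖ * ‖X ω'‖ :=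
        (mul_le_mul_of_nonneg_left (hrB y hy) hxpos.le).trans
          (hyx'.le.trans ((L ω).le_opNorm _))
      have h2 : ‖L ω‖ * 2 ≤ c * r := by
        have := le_max_right 1 (‖L ω‖ / r * 2)
        rw [div_mul_eq_mul_div, div_le_iff₀ hr] at this
        rwa [hc, div_mul_eq_mul_div]
      have h3 : 0 < x * r := mul_pos hxpos hr
      have h4 : ‖L ω‖ * 2 * ‖X ω'‖ ≤ c * r * ‖X ω'‖ := by gcongr
      change x / c < ‖X ω'‖
      rw [div_lt_iff₀ (by positivity)]
      refine lt_of_mul_lt_mul_right ?_ hr.le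
      linarith
    have hcβ : c ^ (α + δ) ≤ 1 + ‖L ω‖ ^ (α + δ) / r ^ (α + δ) * 2 ^ (α + δ) := by
      rw [← Real.div_rpow (norm_nonneg _) hr.le, ← Real.mul_rpow (by positivity) two_pos.le, hc]
      rcases max_cases 1 (‖L ω‖ / r * 2) with ⟨h, -⟩ | ⟨h, -⟩ <;> rw [h]
      · rw [Real.one_rpow]
        exact le_add_of_nonneg_right (by positivity)
      · exact le_add_of_nonneg_left zero_le_one
    calc (P (X ⁻¹' {z | L ω z ∈ x • B})).toReal ≤ P.real {ω' | x / c < ‖X ω'‖} :=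
          measureReal_mono hsub
      _ ≤ C * c ^ (α + δ) * P.real {ω | x < ‖X ω‖} := hbd c hc1
      _ ≤ C * (1 + ‖L ω‖ ^ (α + δ) / r ^ (α + δ) * 2 ^ (α + δ)) * P.real {ω | x < ‖X ω‖} := by
          gcongr
  · exact (((integrable_const 1).add ((hmom.div_const _).mul_const _)).const_mul C)
  · filter_upwards [hfr] with ω hω
    have hcont := (L ω).continuous
    have hzero : (0 : EuclideanSpace ℝ (Fin d)) ∉ closure (L ω ⁻¹' B) := fun h0 => hB0 (by
      have : L ω 0 ∈ closure B := hcont.closure_preimage_subset B h0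
      rwa [map_zero] at this)
    have hfrω : μ (frontier (L ω ⁻¹' B)) = 0 :=
      measure_mono_null (hcont.frontier_preimage_subset B) hω
    refine (hRVX.2.2.2.2.2 _ (hcont.measurable hBmeas) hzero hfrω).congr' ?_
    filter_upwards [eventually_gt_atTop 0] with x hx
    have heq : x • (L ω ⁻¹' B) = {z | L ω z ∈ x • B} := by
      ext z
      simp [Set.mem_smul_set_iff_inv_smul_mem₀ hx.ne']
    rw [heq]
end
end
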